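/- arXiv:2007.05716 — 5 statements merged into one kernel-verified Lean document; each statement's English description precedes it below -/
import Mathlib

section
/- Let A be an invertible p×p real matrix, b ∈ ℝ^p, and let the sequence (s_n) in ℝ^p be generated by the fixed point iteration s_{n+1} = b − (A − I) s_n from an arbitrary s_0. Set r_0 = b − A s_0. Then for every n ≥ 0, span{Δs_0, Δs_1, …, Δs_n} = span{r_0, A r_0, …, A^n r_0}, the Krylov subspace K_n(A, r_0). -/
open Matrix

theorem krylov_aux {p : ℕ} (A : Matrix (Fin p) (Fin p) ℝ) (r : Fin p → ℝ) (i : ℕ) :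
    ((1 - A) ^ i).mulVec r ∈
      Submodule.span ℝ {v : Fin p → ℝ | ∃ j ≤ i, v = (A ^ j).mulVec r} := by
  induction i with
  | zero => exact Submodule.subset_span ⟨0, le_rfl, by simp⟩
  | succ i ih =>
    rw [pow_succ', ← Matrix.mulVec_mulVec, Matrix.sub_mulVec, Matrix.one_mulVec]
    refine Submodule.sub_mem _ ?_ ?_
    · refine Submodule.span_mono ?_ ih
      rintro v ⟨j, hj, rfl⟩
      exact ⟨j, by omega, rfl⟩
    · generalize ((1 - A) ^ i).mulVec r = w at ih
      induction ih using Submodule.span_induction with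
      | mem x hx =>
        obtain ⟨j, hj, rfl⟩ := hx
        exact Submodule.subset_span ⟨j + 1, by omega, by
          rw [pow_succ', ← Matrix.mulVec_mulVec]⟩
      | zero => simp
      | add x y _ _ hx hy => rw [Matrix.mulVec_add]; exact Submodule.add_mem _ hx hy
      | smul c x _ hx => rw [Matrix.mulVec_smul]; exact Submodule.smul_mem _ c hx

theorem krylov_le {p : ℕ} (A : Matrix (Fin p) (Fin p) ℝ) (r : Fin p → ℝ) (n : ℕ) :
    Submodule.span ℝ {v : Fin p → ℝ | ∃ i ≤ n, v = ((1 - A) ^ i).mulVec r} ≤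
      Submodule.span ℝ {v : Fin p → ℝ | ∃ i ≤ n, v = (A ^ i).mulVec r} := by
  rw [Submodule.span_le]
  rintro v ⟨i, hi, rfl⟩
  refine Submodule.span_mono ?_ (krylov_aux A r i)
  rintro v ⟨j, hj, rfl⟩
  exact ⟨j, by omega, rfl⟩

/-- For the fixed point iteration `s_{n+1} = b - (A - I) s_n` with `A` invertible and
`r_0 = b - A s_0`, the span of the forward differences `Δs_0, …, Δs_n` coincides with the
Krylov subspace `span {r_0, A r_0, …, A^n r_0}` for every `n ≥ 0`. -/
theorem shanks_krylov (p : ℕ) (A : Matrix (Fin p) (Fin p) ℝ) (hA : IsUnit A)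
    (b : Fin p → ℝ) (s : ℕ → Fin p → ℝ)
    (hs : ∀ n, s (n + 1) = b - (A - 1).mulVec (s n))
    (r0 : Fin p → ℝ) (hr0 : r0 = b - A.mulVec (s 0)) :
    ∀ n : ℕ,
      Submodule.span ℝ {v : Fin p → ℝ | ∃ i ≤ n, v = s (i + 1) - s i} =
        Submodule.span ℝ {v : Fin p → ℝ | ∃ i ≤ n, v = (A ^ i).mulVec r0} := by
  have key : ∀ i, s (i + 1) - s i = ((1 - A) ^ i).mulVec r0 := by
    intro i
    induction i with
    | zero =>
      rw [hs, hr0, Matrix.sub_mulVec, Matrix.one_mulVec, pow_zero, Matrix.one_mulVec]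
      abel
    | succ i ih =>
      rw [pow_succ', ← Matrix.mulVec_mulVec, ← ih, Matrix.mulVec_sub, hs (i + 1)]
      have e := hs i
      simp only [Matrix.sub_mulVec, Matrix.one_mulVec] at e ⊢
      linear_combination -e
  intro n
  simp only [key]
  refine le_antisymm (krylov_le A r0 n) ?_
  have h := krylov_le (1 - A) r0 n
  rwa [sub_sub_cancel] at h
end

section
/- Let ΔS and ΔF be real p×m matrices with ΔFᵀ ΔF invertible, and β ∈ ℝ. Then H^{(β)} = −β I + (ΔS + β ΔF)(ΔFᵀ ΔF)⁻¹ ΔFᵀ is the unique p×p real matrix B satisfying B ΔF = ΔS and B z = −β z for every z ∈ ℝ^p orthogonal to the column space of ΔF. -/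
open Matrix

/-- The Anderson mixing matrix `H^{(β)}` is the unique matrix `B` with `B ΔF = ΔS` and
`B z = -β z` for every `z` orthogonal to the column space of `ΔF` (i.e. `ΔFᵀ z = 0`). -/
theorem anderson_mixing_unique (p m : ℕ)
    (ΔS ΔF : Matrix (Fin p) (Fin m) ℝ) (hF : IsUnit (ΔFᵀ * ΔF)) (β : ℝ)
    (H : Matrix (Fin p) (Fin p) ℝ)
    (hH : H = (-β) • (1 : Matrix (Fin p) (Fin p) ℝ) +
      (ΔS + β • ΔF) * (ΔFᵀ * ΔF)⁻¹ * ΔFᵀ) :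
    (H * ΔF = ΔS ∧ ∀ z : Fin p → ℝ, ΔFᵀ.mulVec z = 0 → H.mulVec z = (-β) • z) ∧
      ∀ B : Matrix (Fin p) (Fin p) ℝ,
        (B * ΔF = ΔS ∧ ∀ z : Fin p → ℝ, ΔFᵀ.mulVec z = 0 → B.mulVec z = (-β) • z) →
        B = H := by
  have hdet : IsUnit (ΔFᵀ * ΔF).det := (Matrix.isUnit_iff_isUnit_det _).mp hF
  have h1 : H * ΔF = ΔS := by
    rw [hH, Matrix.add_mul, Matrix.mul_assoc _ ΔFᵀ ΔF, Matrix.mul_assoc _ _ (ΔFᵀ * ΔF),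
      Matrix.nonsing_inv_mul _ hdet, Matrix.mul_one, Matrix.smul_mul, Matrix.one_mul, neg_smul]
    abel
  have h2 : ∀ z : Fin p → ℝ, ΔFᵀ.mulVec z = 0 → H.mulVec z = (-β) • z := by
    intro z hz
    rw [hH, Matrix.add_mulVec, ← Matrix.mulVec_mulVec, hz, Matrix.mulVec_zero, add_zero,
      Matrix.smul_mulVec, Matrix.one_mulVec]
  refine ⟨⟨h1, h2⟩, ?_⟩
  rintro B ⟨hB1, hB2⟩
  apply Matrix.mulVec_injective
  funext x
  have hz : ΔFᵀ.mulVec (x - ΔF.mulVec ((ΔFᵀ * ΔF)⁻¹.mulVec (ΔFᵀ.mulVec x))) = 0 := by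
    rw [Matrix.mulVec_sub, Matrix.mulVec_mulVec _ ΔFᵀ ΔF, Matrix.mulVec_mulVec _ (ΔFᵀ * ΔF),
      Matrix.mul_nonsing_inv _ hdet, Matrix.one_mulVec, sub_self]
  have e := (hB2 _ hz).trans (h2 _ hz).symm
  rw [Matrix.mulVec_sub, Matrix.mulVec_sub, Matrix.mulVec_mulVec _ B ΔF,
    Matrix.mulVec_mulVec _ H ΔF, hB1, h1] at e
  exact sub_left_injective e
end

section
/- Let Δf_1, …, Δf_m and Δs_1, …, Δs_m be vectors in ℝ^p, and let f̂_1, …, f̂_m be their Gram–Schmidt orthogonalization: f̂_1 = Δf_1 and f̂_d = (I − Σ_{p=1}^{d−1} f̂_p f̂_pᵀ/(f̂_pᵀ f̂_p)) Δf_d for d ≥ 2, and assume each f̂_d is nonzero. Fix β ∈ ℝ and define recursively H^0 = −β I and H^d = H^{d−1} + (Δs_d − H^{d−1} Δf_d) f̂_dᵀ / (f̂_dᵀ Δf_d) for d = 1, …, m. Then for every d and every p ≤ d, H^d Δf_p = Δs_p, and H^m = −β I + (ΔS + β ΔF)(ΔFᵀ ΔF)⁻¹ ΔFᵀ where ΔF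 = [Δf_1, …, Δf_m] and ΔS = [Δs_1, …, Δs_m]. -/
open Matrix

/-- Broyden-type recursion for the Anderson mixing matrix: if `f̂_1, …, f̂_m` is the
Gram–Schmidt orthogonalization of `Δf_1, …, Δf_m` (all `f̂_d` nonzero), and
`H^d = H^{d-1} + (Δs_d - H^{d-1} Δf_d) f̂_dᵀ / (f̂_dᵀ Δf_d)` starting from `H^0 = -β I`,
then `H^d Δf_q = Δs_q` for all `q ≤ d`, and
`H^m = -β I + (ΔS + β ΔF)(ΔFᵀΔF)⁻¹ΔFᵀ`. -/
theorem anderson_recursion_multisecant (p m : ℕ) (hm : 1 ≤ m)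
    (df ds : ℕ → Fin p → ℝ)
    (fh : ℕ → Fin p → ℝ)
    (hfh1 : fh 1 = df 1)
    (hfh : ∀ d, 2 ≤ d → d ≤ m →
      fh d = df d - ∑ q ∈ Finset.Ico 1 d, ((fh q ⬝ᵥ df d) / (fh q ⬝ᵥ fh q)) • fh q)
    (hnz : ∀ d, 1 ≤ d → d ≤ m → fh d ≠ 0)
    (β : ℝ)
    (H : ℕ → Matrix (Fin p) (Fin p) ℝ)
    (hH0 : H 0 = (-β) • (1 : Matrix (Fin p) (Fin p) ℝ))
    (hH : ∀ d, 1 ≤ d → d ≤ m →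
      H d = H (d - 1) +
        (fh d ⬝ᵥ df d)⁻¹ • vecMulVec (ds d - (H (d - 1)).mulVec (df d)) (fh d))
    (ΔF ΔS : Matrix (Fin p) (Fin m) ℝ)
    (hΔF : ΔF = Matrix.of fun i (j : Fin m) => df ((j : ℕ) + 1) i)
    (hΔS : ΔS = Matrix.of fun i (j : Fin m) => ds ((j : ℕ) + 1) i) :
    (∀ d, d ≤ m → ∀ q, 1 ≤ q → q ≤ d → (H d).mulVec (df q) = ds q) ∧
      H m = (-β) • (1 : Matrix (Fin p) (Fin p) ℝ) +
        (ΔS + β • ΔF) * (ΔFᵀ * ΔF)⁻¹ * ΔFᵀ := by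
  have hGS : ∀ d, 1 ≤ d → d ≤ m →
      fh d = df d - ∑ q ∈ Finset.Ico 1 d, ((fh q ⬝ᵥ df d) / (fh q ⬝ᵥ fh q)) • fh q := by
    intro d h1 h2
    rcases Nat.lt_or_ge 1 d with h | h
    · exact hfh d h h2
    · obtain rfl : d = 1 := le_antisymm h h1
      simp [hfh1]
  have hself : ∀ d, 1 ≤ d → d ≤ m → fh d ⬝ᵥ fh d ≠ 0 := by
    intro d h1 h2 h
    exact hnz d h1 h2 (dotProduct_self_eq_zero.mp h)
  have horth : ∀ d, d ≤ m → ∀ q, 1 ≤ q → q < d → fh q ⬝ᵥ fh d = 0 := by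
    intro d
    induction d using Nat.strong_induction_on with
    | _ d ih =>
      intro hd q hq hqd
      rw [hGS d (by omega) hd, dotProduct_sub, dotProduct_sum,
        Finset.sum_eq_single_of_mem q (Finset.mem_Ico.mpr ⟨hq, hqd⟩)]
      · rw [dotProduct_smul, smul_eq_mul, div_mul_cancel₀ _ (hself q hq (by omega)), sub_self]
      · intro r hr hrq
        rw [Finset.mem_Ico] at hr
        rw [dotProduct_smul]
        rcases lt_or_gt_of_ne hrq with h | h
        · rw [dotProduct_comm (fh q) (fh r), ih q hqd (by omega) r hr.1 h, smul_zero]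
        · rw [ih r hr.2 (by omega) q hq h, smul_zero]
  have hdf : ∀ d, 1 ≤ d → d ≤ m →
      df d = fh d + ∑ q ∈ Finset.Ico 1 d, ((fh q ⬝ᵥ df d) / (fh q ⬝ᵥ fh q)) • fh q := by
    intro d h1 h2
    exact sub_eq_iff_eq_add.mp (hGS d h1 h2).symm
  have hdiag : ∀ d, 1 ≤ d → d ≤ m → fh d ⬝ᵥ df d ≠ 0 := by
    intro d h1 h2
    have : fh d ⬝ᵥ df d = fh d ⬝ᵥ fh d := by
      rw [hdf d h1 h2, dotProduct_add, dotProduct_sum, Finset.sum_eq_zero, add_zero]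
      intro r hr
      rw [Finset.mem_Ico] at hr
      rw [dotProduct_smul, dotProduct_comm (fh d) (fh r), horth d h2 r hr.1 hr.2, smul_zero]
    rw [this]
    exact hself d h1 h2
  have hlow : ∀ d, d ≤ m → ∀ q, 1 ≤ q → q < d → fh d ⬝ᵥ df q = 0 := by
    intro d hd q hq hqd
    rw [hdf q hq (by omega), dotProduct_add, dotProduct_sum, Finset.sum_eq_zero, add_zero,
      dotProduct_comm, horth d hd q hq hqd]
    intro r hr
    rw [Finset.mem_Ico] at hr
    rw [dotProduct_smul, dotProduct_comm (fh d) (fh r), horth d hd r hr.1 (by omega), smul_zero]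
  have hsec : ∀ d, d ≤ m → ∀ q, 1 ≤ q → q ≤ d → (H d).mulVec (df q) = ds q := by
    intro d
    induction d with
    | zero => intro _ q h1 h2; omega
    | succ d ih =>
      intro hd q h1 h2
      rw [hH (d + 1) (by omega) hd, Nat.add_sub_cancel, add_mulVec, smul_mulVec,
        vecMulVec_mulVec]
      rcases Nat.lt_or_ge q (d + 1) with h | h
      · rw [hlow (d + 1) hd q h1 h, ih (by omega) q h1 (by omega)]
        simp
      · obtain rfl : q = d + 1 := le_antisymm h2 h
        have h0 := hdiag (d + 1) h1 hd
        ext i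
        simp only [Pi.add_apply, Pi.smul_apply, Pi.sub_apply, smul_eq_mul,
          MulOpposite.smul_eq_mul_unop, MulOpposite.unop_op]
        field_simp
        ring
  refine ⟨hsec, ?_⟩
  have hcol : ∀ d, 1 ≤ d → d ≤ m → df d ∈ LinearMap.range ΔF.mulVecLin := by
    intro d h1 h2
    refine ⟨Pi.single (⟨d - 1, by omega⟩ : Fin m) 1, ?_⟩
    ext i
    simp [hΔF, Nat.sub_add_cancel h1]
  have hran : ∀ d, 1 ≤ d → d ≤ m → fh d ∈ LinearMap.range ΔF.mulVecLin := by
    intro d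
    induction d using Nat.strong_induction_on with
    | _ d ih =>
      intro h1 h2
      rw [hGS d h1 h2]
      refine Submodule.sub_mem _ (hcol d h1 h2) (Submodule.sum_mem _ fun r hr => ?_)
      rw [Finset.mem_Ico] at hr
      exact Submodule.smul_mem _ _ (ih r hr.2 hr.1 (by omega))
  have hc : ∀ d, ∃ c : Fin m → ℝ, 1 ≤ d → d ≤ m → ΔF *ᵥ c = fh d := by
    intro d
    by_cases h : 1 ≤ d ∧ d ≤ m
    · obtain ⟨c, hc⟩ := hran d h.1 h.2
      exact ⟨c, fun _ _ => hc⟩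
    · exact ⟨0, fun h1 h2 => absurd ⟨h1, h2⟩ h⟩
  choose c hc using hc
  have hA : ∀ d, d ≤ m → ∃ A : Matrix (Fin p) (Fin m) ℝ,
      H d = (-β) • (1 : Matrix (Fin p) (Fin p) ℝ) + A * ΔFᵀ := by
    intro d
    induction d with
    | zero => intro _; exact ⟨0, by simp [hH0]⟩
    | succ d ih =>
      intro hd
      obtain ⟨A, hA⟩ := ih (by omega)
      refine ⟨A + (fh (d + 1) ⬝ᵥ df (d + 1))⁻¹ •
        vecMulVec (ds (d + 1) - (H d).mulVec (df (d + 1))) (c (d + 1)), ?_⟩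
      rw [hH (d + 1) (by omega) hd, Nat.add_sub_cancel, Matrix.add_mul, Matrix.smul_mul,
        vecMulVec_mul, vecMul_transpose, hc (d + 1) (by omega) hd, ← add_assoc, ← hA]
  obtain ⟨A, hA⟩ := hA m le_rfl
  have hHF : H m * ΔF = ΔS := by
    ext i j
    have := congrFun (hsec m le_rfl (j + 1) (by omega) (by omega)) i
    rw [hΔS, of_apply, ← this, hΔF]
    rfl
  have hAG : A * (ΔFᵀ * ΔF) = ΔS + β • ΔF := by
    rw [← hHF, hA, Matrix.add_mul, Matrix.smul_mul, Matrix.one_mul, Matrix.mul_assoc]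
    module
  let C : Matrix (Fin m) (Fin m) ℝ := Matrix.of fun j => c ((j : ℕ) + 1)
  have hT : ∀ j k : Fin m, (C * (ΔFᵀ * ΔF)) j k = fh (j + 1) ⬝ᵥ df (k + 1) := by
    intro j k
    rw [← Matrix.mul_assoc, ← hc (j + 1) (by omega) (by omega), ← vecMul_transpose]
    simp only [hΔF]
    rfl
  have hdet : (C * (ΔFᵀ * ΔF)).det ≠ 0 := by
    rw [det_of_isUpperTriangular]
    · refine Finset.prod_ne_zero_iff.mpr fun j _ => ?_
      rw [hT]
      exact hdiag _ (by omega) (by omega)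
    · intro j k hjk
      rw [hT]
      have : (k : ℕ) < j := hjk
      exact hlow _ (by omega) _ (by omega) (by omega)
  rw [det_mul] at hdet
  have hu : IsUnit (ΔFᵀ * ΔF).det := isUnit_iff_ne_zero.mpr (right_ne_zero_of_mul hdet)
  rw [← hAG, mul_nonsing_inv_cancel_right _ _ hu, hA]
end

section
/- Let Δf_1, …, Δf_m and Δs_1, …, Δs_m be vectors in ℝ^p, let f̂_1, …, f̂_m be the Gram–Schmidt orthogonalization of the Δf_d, assumed all nonzero, and fix β ∈ ℝ. Define H^0 = −β I, ŝ_1 = Δs_1, Q^{d−1} = Σ_{p=1}^{d−1} f̂_p f̂_pᵀ/(f̂_pᵀ f̂_p), ŝ_d = Δs_d − H^{d−1} Q^{d−1} Δf_d for d ≥ 2, and H^d = H^{d−1} + (ŝ_d − H^{d−1} f̂_d) f̂_dᵀ / (f̂_dᵀ f̂_d). Then this recursion produces the same matrices H^d as the recursion H^d = H^{d−1} + (Δs_d − H^{d−1} Δf_d) f̂_dᵀ / (f̂_dᵀ Δf_d), and in particular H^d f̂_p = ŝ_p for all p ≤ d. -/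
open Matrix

/-- Equivalence of the two Anderson/Broyden recursions: with `f̂` the (nonzero)
Gram–Schmidt orthogonalization of the `Δf`, `ŝ_1 = Δs_1`,
`ŝ_d = Δs_d - H'^{d-1} Q^{d-1} Δf_d`, the recursion
`H'^d = H'^{d-1} + (ŝ_d - H'^{d-1} f̂_d) f̂_dᵀ/(f̂_dᵀ f̂_d)` produces the same matrices as
`H^d = H^{d-1} + (Δs_d - H^{d-1} Δf_d) f̂_dᵀ/(f̂_dᵀ Δf_d)`, and `H'^d f̂_q = ŝ_q` for `q ≤ d`. -/
theorem anderson_recursion_equivalence (p m : ℕ) (hm : 1 ≤ m)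
    (df ds : ℕ → Fin p → ℝ)
    (fh : ℕ → Fin p → ℝ)
    (hfh1 : fh 1 = df 1)
    (hfh : ∀ d, 2 ≤ d → d ≤ m →
      fh d = df d - ∑ q ∈ Finset.Ico 1 d, ((fh q ⬝ᵥ df d) / (fh q ⬝ᵥ fh q)) • fh q)
    (hnz : ∀ d, 1 ≤ d → d ≤ m → fh d ≠ 0)
    (β : ℝ)
    -- first recursion, in terms of `Δs`, `Δf`
    (H : ℕ → Matrix (Fin p) (Fin p) ℝ)
    (hH0 : H 0 = (-β) • (1 : Matrix (Fin p) (Fin p) ℝ))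
    (hH : ∀ d, 1 ≤ d → d ≤ m →
      H d = H (d - 1) +
        (fh d ⬝ᵥ df d)⁻¹ • vecMulVec (ds d - (H (d - 1)).mulVec (df d)) (fh d))
    -- second recursion, in the orthogonalized variables `ŝ`, `f̂`
    (H' : ℕ → Matrix (Fin p) (Fin p) ℝ)
    (sh : ℕ → Fin p → ℝ)
    (hH'0 : H' 0 = (-β) • (1 : Matrix (Fin p) (Fin p) ℝ))
    (hsh1 : sh 1 = ds 1)
    (hsh : ∀ d, 2 ≤ d → d ≤ m →
      sh d = ds d - (H' (d - 1)).mulVec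
        ((∑ q ∈ Finset.Ico 1 d, (fh q ⬝ᵥ fh q)⁻¹ • vecMulVec (fh q) (fh q)).mulVec (df d)))
    (hH' : ∀ d, 1 ≤ d → d ≤ m →
      H' d = H' (d - 1) +
        (fh d ⬝ᵥ fh d)⁻¹ • vecMulVec (sh d - (H' (d - 1)).mulVec (fh d)) (fh d)) :
    (∀ d, d ≤ m → H' d = H d) ∧
      ∀ d, d ≤ m → ∀ q, 1 ≤ q → q ≤ d → (H' d).mulVec (fh q) = sh q := by
  have hGS : ∀ d, 1 ≤ d → d ≤ m →
      df d = fh d + ∑ q ∈ Finset.Ico 1 d, ((fh q ⬝ᵥ df d) / (fh q ⬝ᵥ fh q)) • fh q := by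
    intro d h1 h2
    rcases Nat.lt_or_ge 1 d with h | h
    · have := hfh d h h2
      exact (sub_eq_iff_eq_add.mp this.symm)
    · obtain rfl : d = 1 := by omega
      simp [hfh1]
  have hpos : ∀ d, 1 ≤ d → d ≤ m → fh d ⬝ᵥ fh d ≠ 0 := by
    intro d h1 h2 h
    exact hnz d h1 h2 (dotProduct_self_eq_zero.mp h)
  have horth : ∀ d, d ≤ m → ∀ q, 1 ≤ q → q < d → fh q ⬝ᵥ fh d = 0 := by
    intro d
    induction d using Nat.strong_induction_on with
    | _ d ih =>
      intro hd q hq hqd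
      have h := congrArg (fun v => fh q ⬝ᵥ v) (hGS d (by omega) hd)
      simp only [dotProduct_add, dotProduct_sum, dotProduct_smul, smul_eq_mul] at h
      rw [Finset.sum_eq_single q] at h
      · rw [div_mul_cancel₀ _ (hpos q hq (by omega))] at h
        linarith
      · intro r hr hrq
        rw [Finset.mem_Ico] at hr
        rcases Nat.lt_or_gt_of_ne hrq with h' | h'
        · rw [dotProduct_comm (fh q), ih q hqd (by omega) r hr.1 h', mul_zero]
        · rw [ih r hr.2 (by omega) q hq h', mul_zero]
      · intro hn
        exact absurd (Finset.mem_Ico.mpr ⟨hq, hqd⟩) hn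
  have hdot : ∀ d, 1 ≤ d → d ≤ m → fh d ⬝ᵥ df d = fh d ⬝ᵥ fh d := by
    intro d h1 h2
    conv_lhs => rw [hGS d h1 h2]
    rw [dotProduct_add, dotProduct_sum, Finset.sum_eq_zero, add_zero]
    intro q hq
    rw [Finset.mem_Ico] at hq
    rw [dotProduct_smul, dotProduct_comm (fh d), horth d h2 q hq.1 hq.2, smul_zero]
  have hQ : ∀ d, 
      (∑ q ∈ Finset.Ico 1 d, (fh q ⬝ᵥ fh q)⁻¹ • vecMulVec (fh q) (fh q)).mulVec (df d)
        = ∑ q ∈ Finset.Ico 1 d, ((fh q ⬝ᵥ df d) / (fh q ⬝ᵥ fh q)) • fh q := by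
    intro d
    rw [Matrix.sum_mulVec]
    refine Finset.sum_congr rfl fun q _ => ?_
    rw [smul_mulVec, vecMulVec_mulVec]
    ext i
    simp [div_eq_mul_inv]
    ring
  have hres : ∀ d, 1 ≤ d → d ≤ m →
      sh d - (H' (d - 1)).mulVec (fh d) = ds d - (H' (d - 1)).mulVec (df d) := by
    intro d h1 h2
    rcases Nat.lt_or_ge 1 d with h | h
    · rw [hsh d h h2, hQ]
      conv_rhs => rw [hGS d h1 h2, mulVec_add]
      abel
    · obtain rfl : d = 1 := by omega
      rw [hsh1, hfh1]
  constructor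
  · intro d
    induction d with
    | zero => intro _; rw [hH0, hH'0]
    | succ d ih =>
      intro hd
      rw [hH' (d + 1) (by omega) hd, hH (d + 1) (by omega) hd, hres (d + 1) (by omega) hd,
        hdot (d + 1) (by omega) hd, Nat.add_sub_cancel, ih (by omega)]
  · intro d
    induction d with
    | zero => intro _ q h1 h2; omega
    | succ d ih =>
      intro hd q h1 h2
      rw [hH' (d + 1) (by omega) hd, add_mulVec, smul_mulVec, vecMulVec_mulVec,
        Nat.add_sub_cancel]
      rcases Nat.lt_or_ge q (d + 1) with h | h
      · rw [ih (by omega) q h1 (by omega), dotProduct_comm (fh (d + 1)) (fh q), horth (d + 1) hd q h1 h]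
        simp
      · obtain rfl : q = d + 1 := by omega
        have := hpos (d + 1) h1 hd
        ext i
        simp
        field_simp
        ring
end

section
/- Let F : ℝ^n → ℝ^n be differentiable on an open convex set E, s* ∈ E with F(s*) = 0, J = F'(s*) invertible, and ‖F'(x) − J‖ ≤ L‖x − s*‖ on E. Let ρ > 0 and ε > 0 be such that the closed ball U_ε(s*) ⊆ E and ‖F(u) − F(s*)‖ ≤ ρ ‖u − s*‖ for all u ∈ U_ε(s*). Let s ∈ U_ε(s*), let H be an n×n real matrix with ‖H − J⁻¹‖ ≤ δ + α ε for some δ, α ≥ 0, and set q = ‖J⁻¹‖ L ε + ρ (δ + α ε). Then the iterate s' = s − H F(s) satisfies ‖s' − s*‖ ≤ q ‖s − s*‖; in particular, if q ≤ 1 then s' ∈ U_ε(s*). -/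
/-- One-step contraction estimate for the stabilized Anderson iteration: if
`s ∈ U_ε(s*)`, `‖H - J⁻¹‖ ≤ δ + α ε`, and `q = ‖J⁻¹‖ L ε + ρ (δ + α ε)`, then the iterate
`s' = s - H F(s)` satisfies `‖s' - s*‖ ≤ q ‖s - s*‖`; in particular, if `q ≤ 1` then
`s' ∈ U_ε(s*)`. -/
theorem anderson_one_step_contraction (n : ℕ)
    (E : Set (EuclideanSpace ℝ (Fin n))) (hE : IsOpen E) (hconv : Convex ℝ E)
    (F : EuclideanSpace ℝ (Fin n) → EuclideanSpace ℝ (Fin n))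
    (F' : EuclideanSpace ℝ (Fin n) →
      EuclideanSpace ℝ (Fin n) →L[ℝ] EuclideanSpace ℝ (Fin n))
    (hdiff : ∀ x ∈ E, HasFDerivAt F (F' x) x)
    (sstar : EuclideanSpace ℝ (Fin n)) (hsstar : sstar ∈ E)
    (hzero : F sstar = 0)
    (Jinv : EuclideanSpace ℝ (Fin n) →L[ℝ] EuclideanSpace ℝ (Fin n))
    (hJ1 : (F' sstar).comp Jinv = ContinuousLinearMap.id ℝ (EuclideanSpace ℝ (Fin n)))
    (hJ2 : Jinv.comp (F' sstar) = ContinuousLinearMap.id ℝ (EuclideanSpace ℝ (Fin n)))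
    (L : ℝ) (hLip : ∀ x ∈ E, ‖F' x - F' sstar‖ ≤ L * ‖x - sstar‖)
    (ρ ε : ℝ) (hρ : 0 < ρ) (hε : 0 < ε)
    (hball : Metric.closedBall sstar ε ⊆ E)
    (hupper : ∀ u ∈ Metric.closedBall sstar ε, ‖F u - F sstar‖ ≤ ρ * ‖u - sstar‖)
    (s : EuclideanSpace ℝ (Fin n)) (hs : s ∈ Metric.closedBall sstar ε)
    (H : EuclideanSpace ℝ (Fin n) →L[ℝ] EuclideanSpace ℝ (Fin n))
    (δ α : ℝ) (hδ : 0 ≤ δ) (hα : 0 ≤ α)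
    (hH : ‖H - Jinv‖ ≤ δ + α * ε)
    (q : ℝ) (hq : q = ‖Jinv‖ * L * ε + ρ * (δ + α * ε))
    (s' : EuclideanSpace ℝ (Fin n)) (hs' : s' = s - H (F s)) :
    ‖s' - sstar‖ ≤ q * ‖s - sstar‖ ∧ (q ≤ 1 → s' ∈ Metric.closedBall sstar ε) := by
  have hsn : ‖s - sstar‖ ≤ ε := by simpa [dist_eq_norm] using hs
  have key : ‖s' - sstar‖ ≤ q * ‖s - sstar‖ := by
    by_cases hne : s = sstar
    · subst hne
      simp [hs', hzero]
    have hpos : 0 < ‖s - sstar‖ := norm_pos_iff.mpr (sub_ne_zero.mpr hne)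
    have hL : 0 ≤ L := by
      have h1 := (norm_nonneg _).trans (hLip s (hball hs))
      exact nonneg_of_mul_nonneg_left h1 hpos
    have hmv : ‖F s - F sstar - F' sstar (s - sstar)‖ ≤ (L * ε) * ‖s - sstar‖ := by
      refine Convex.norm_image_sub_le_of_norm_hasFDerivWithin_le' (f' := F')
        (fun x hx => (hdiff x (hball hx)).hasFDerivWithinAt) (fun x hx => ?_)
        (convex_closedBall sstar ε) (Metric.mem_closedBall_self hε.le) hs
      have hx' : ‖x - sstar‖ ≤ ε := by simpa [dist_eq_norm] using hx
      exact (hLip x (hball hx)).trans (mul_le_mul_of_nonneg_left hx' hL)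
    have hid : Jinv (F' sstar (s - sstar)) = s - sstar := by
      have := congrArg (fun T => T (s - sstar)) hJ2
      simpa using this
    have hdec : s' - sstar = -(Jinv (F s - F sstar - F' sstar (s - sstar)))
        - (H - Jinv) (F s - F sstar) := by
      rw [map_sub Jinv (F s - F sstar), hid, hs', hzero, sub_zero, ContinuousLinearMap.sub_apply]
      abel
    have h1 : ‖Jinv (F s - F sstar - F' sstar (s - sstar))‖
        ≤ ‖Jinv‖ * ((L * ε) * ‖s - sstar‖) :=
      Jinv.le_opNorm_of_le hmv
    have h2 : ‖(H - Jinv) (F s - F sstar)‖ ≤ (δ + α * ε) * (ρ * ‖s - sstar‖) :=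
      (H - Jinv).le_of_opNorm_le_of_le hH (hupper s hs)
    rw [hdec, hq]
    refine (norm_sub_le _ _).trans ?_
    rw [norm_neg]
    linarith
  refine ⟨key, fun hq1 => ?_⟩
  rw [Metric.mem_closedBall, dist_eq_norm]
  nlinarith [norm_nonneg (s - sstar)]
end
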